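/- For α ∈ V*, there exists u ∈ V with (u,α) ∈ F(A) if and only if Φ(α) = 0; that is, the image of F(A) under the projection V × V* → V* is exactly the kernel of Φ. (This is the kernel computation in the proof of Proposition 3.4 of the paper.) -/

import Mathlib

/-- The symmetric bilinear pairing on `E = 𝔻 × (V × V*)`:
`⟪(d₁,(u₁,α₁)),(d₂,(u₂,α₂))⟫ = ⟨d₁,d₂⟩ + (1/2)(α₁(u₂) + α₂(u₁))`. -/
noncomputable def pairE {D V : Type*} [AddCommGroup D] [Module ℝ D] [AddCommGroup V] [Module ℝ V]
    (B : LinearMap.BilinForm ℝ D) (p q : D × V × Module.Dual ℝ V) : ℝ :=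
  B p.1 q.1 + (1 / 2) * (p.2.2 q.2.1 + q.2.2 p.2.1)

/-- A subspace `F ⊆ E` that contains its orthogonal and meets `{0} × (V × {0})` trivially
projects onto `V*`. -/
theorem exists_mem_of_inter_eq_zero
    {D V : Type*} [AddCommGroup D] [Module ℝ D]
    [AddCommGroup V] [Module ℝ V] [FiniteDimensional ℝ V]
    (B : LinearMap.BilinForm ℝ D) (F : Submodule ℝ (D × V × Module.Dual ℝ V))
    (hF : ∀ e, (∀ f ∈ F, pairE B e f = 0) → e ∈ F)
    (hFi : ∀ u : V, ((0 : D), u, (0 : Module.Dual ℝ V)) ∈ F → u = 0)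
    (α : Module.Dual ℝ V) : ∃ (d : D) (u : V), (d, u, α) ∈ F := by
  let P : Subspace ℝ (Module.Dual ℝ V) :=
    F.map (LinearMap.snd ℝ V (Module.Dual ℝ V) ∘ₗ LinearMap.snd ℝ D (V × Module.Dual ℝ V))
  have hbot : P.dualCoannihilator = ⊥ := by
    refine (Submodule.eq_bot_iff _).2 fun v hv => hFi v (hF _ fun f hf => ?_)
    have hfv : f.2.2 v = 0 :=
      (Submodule.mem_dualCoannihilator v).1 hv f.2.2 (Submodule.mem_map_of_mem hf)
    simp [pairE, hfv]
  have htop : P = ⊤ := by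
    rw [← Subspace.dualCoannihilator_dualAnnihilator_eq (W := P), hbot,
      Submodule.dualAnnihilator_bot]
  obtain ⟨⟨d, u, β⟩, hf, rfl⟩ : α ∈ P := htop ▸ Submodule.mem_top
  exact ⟨d, u, hf⟩

theorem stmt
    {D V : Type*} [AddCommGroup D] [Module ℝ D] [FiniteDimensional ℝ D]
    [AddCommGroup V] [Module ℝ V] [FiniteDimensional ℝ V]
    (B : LinearMap.BilinForm ℝ D) (hBsymm : B.IsSymm) (hBnd : B.Nondegenerate)
    (A : Submodule ℝ D)
    -- `A = A^⊥` (A is Lagrangian in 𝔻)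
    (hA : (A : Set D) = {d : D | ∀ a ∈ A, B d a = 0})
    (F : Submodule ℝ (D × V × Module.Dual ℝ V))
    -- `F = F^⊥` with respect to the pairing `pairE B` (F is Lagrangian in E)
    (hF : (F : Set (D × V × Module.Dual ℝ V)) =
      {e : D × V × Module.Dual ℝ V | ∀ f ∈ F, pairE B e f = 0})
    -- (i) `F` intersects `{0} × (V × {0})` trivially
    (hFi : ∀ u : V, ((0 : D), u, (0 : Module.Dual ℝ V)) ∈ F → u = 0)
    -- (ii) the image of `F ∩ (𝔻 × (V × {0}))` under the projection `E → 𝔻` equals `A`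
    (hFii : ∀ d : D, d ∈ A ↔ ∃ u : V, (d, u, (0 : Module.Dual ℝ V)) ∈ F)
    -- `σ : A → V` assigns to each `a ∈ A` the (unique) `u` with `(a,(u,0)) ∈ F`
    (σ : A → V) (hσ : ∀ a : A, ((a : D), σ a, (0 : Module.Dual ℝ V)) ∈ F)
    :
    ∀ α : Module.Dual ℝ V,
      (∃ u : V, ∃ a ∈ A, (a, u, α) ∈ F) ↔ (∀ a : A, α (σ a) = 0) := by
  intro α
  have hpair {d : D} {u : V} (h : (d, u, α) ∈ F) (a : A) :
      B d a + 1 / 2 * α (σ a) = 0 := by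
    have h' : (d, u, α) ∈ {e | ∀ f ∈ F, pairE B e f = 0} := hF ▸ h
    simpa [pairE] using h' _ (hσ a)
  constructor
  · rintro ⟨u, d, hd, h⟩ a
    have hd' : d ∈ {d : D | ∀ a ∈ A, B d a = 0} := hA ▸ hd
    linarith [hpair h a, hd' a a.2]
  · intro hα
    obtain ⟨d, u, h⟩ := exists_mem_of_inter_eq_zero B F (fun e he => hF.ge he) hFi α
    refine ⟨u, d, hA.ge fun a ha => ?_, h⟩
    linarith [hpair h ⟨a, ha⟩, hα ⟨a, ha⟩]
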